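/- Let J : ℚ_p^n → [0,∞) satisfy Hypothesis A, and for t ≥ 0 set u(x,t) = ∫_{ℤ_p^n} χ_p(−ξ·x) e^{−t(1−(FJ)(ξ))} d^n ξ and S(t) = ∫_{ℤ_p^n} u(x,t) d^n x (the survival probability in ℤ_p^n). Then S(t) = ∫_{ℤ_p^n} e^{−t(1−(FJ)(ξ))} d^n ξ = (1 − p^{−n}) Σ_{j=0}^∞ p^{−nj} e^{−t(1−(FJ)(p^{−j}))}, where (FJ)(p^{−j}) denotes the common value of FJ on the sphere {‖ξ‖_p = p^{−j}}. -/

import Mathlib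

open MeasureTheory Filter

noncomputable section

namespace PadicPaper

attribute [local instance] Classical.propDecidable

variable (p : ℕ) [Fact p.Prime]

instance : MeasurableSpace ℚ_[p] := borel _
instance : BorelSpace ℚ_[p] := ⟨rfl⟩

variable (n : ℕ)

/-- `ℚ_p^n` with the sup norm `‖x‖ = max |x i|_p`. -/
abbrev V := Fin n → ℚ_[p]

/-- The `p`-adic fractional part of `y`: the unique rational `r ∈ [0,1)` whose denominator is a
power of `p` such that `y - r ∈ ℤ_p`. -/
def frac (y : ℚ_[p]) : ℚ :=
  if h : ∃ r : ℚ, 0 ≤ r ∧ r < 1 ∧ (∃ m : ℕ, (r * (p : ℚ) ^ m).den = 1) ∧ ‖y - (r : ℚ_[p])‖ ≤ 1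
  then h.choose else 0

/-- The standard additive character `χ_p(y) = exp(2 π i {y}_p)` of `ℚ_p`. -/
def stdChar (y : ℚ_[p]) : ℂ := Complex.exp (2 * Real.pi * Complex.I * (frac p y : ℂ))

/-- `ξ·x = Σ ξ_i x_i`. -/
def dotP (ξ x : V p n) : ℚ_[p] := ∑ i, ξ i * x i

/-- Fourier transform with respect to the (normalized Haar) measure `μ`:
`(Ff)(ξ) = ∫ χ_p(ξ·x) f(x) dμ(x)`. -/
def FT (μ : Measure (V p n)) (f : V p n → ℂ) (ξ : V p n) : ℂ :=
  ∫ x, stdChar p (dotP p n ξ x) * f x ∂μ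

/-- `ℤ_p^n` as a subset of `ℚ_p^n`. -/
def Zpn : Set (V p n) := {x | ‖x‖ ≤ 1}

/-- Hypothesis A: `J` is a nonnegative radial a.e.-continuous function with total integral 1. -/
structure HypA (μ : Measure (V p n)) (J : V p n → ℝ) : Prop where
  nonneg : ∀ x, 0 ≤ J x
  radial : ∀ x y : V p n, ‖x‖ = ‖y‖ → J x = J y
  aecont : ∀ᵐ x ∂μ, ContinuousAt J x
  integrable : Integrable J μ
  int_one : ∫ x, J x ∂μ = 1

/-- The Fourier transform of (the complexification of) `J`. -/
def FJ (μ : Measure (V p n)) (J : V p n → ℝ) (ξ : V p n) : ℂ :=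
  FT p n μ (fun x => (J x : ℂ)) ξ

/-- A representative point of `ℚ_p^n` of norm `r` (junk value `0` if no such point exists);
used to evaluate radial functions at a given radius. -/
def repVec (r : ℝ) : V p n :=
  if h : ∃ v : V p n, ‖v‖ = r then h.choose else 0

/-- The heat kernel
`Z_t(x) = ‖x‖^{-n} (1-p^{-n}) Σ_{j≥0} p^{-nj} (e^{-t(1-(FJ)(p^{-j}‖x‖⁻¹))} - e^{-t(1-(FJ)(p‖x‖⁻¹))})`. -/
def heatZ (μ : Measure (V p n)) (J : V p n → ℝ) (t : ℝ) (x : V p n) : ℝ :=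
  ‖x‖ ^ (-(n : ℤ)) * (1 - (p : ℝ) ^ (-(n : ℤ))) * ∑' j : ℕ,
    (p : ℝ) ^ (-((n * j : ℕ) : ℤ)) *
      (Real.exp (-(t * (1 - (FJ p n μ J (repVec p n ((p : ℝ) ^ (-(j : ℤ)) * ‖x‖⁻¹))).re))) -
       Real.exp (-(t * (1 - (FJ p n μ J (repVec p n ((p : ℝ) * ‖x‖⁻¹))).re))))

/-- `J` is of linear type: Hypothesis A together with `B‖x‖^{-(α+1)} ≤ J(x) ≤ C‖x‖^{-(α+1)}`. -/
structure LinearType (μ : Measure (V p n)) (J : V p n → ℝ) (B C α : ℝ) : Prop where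
  hypA : HypA p n μ J
  hB : 0 < B
  hBC : B ≤ C
  hα : 0 < α
  lower : ∀ x : V p n, x ≠ 0 → B / ‖x‖ ^ (α + 1) ≤ J x
  upper : ∀ x : V p n, x ≠ 0 → J x ≤ C / ‖x‖ ^ (α + 1)

/-- `J` is of logarithmic type: Hypothesis A together with
`D ln^α(1+‖x‖)‖x‖^{-β} ≤ J(x) ≤ E ln^α(1+‖x‖)‖x‖^{-β}`. -/
structure LogType (μ : Measure (V p n)) (J : V p n → ℝ) (D E α β : ℝ) : Prop where
  hypA : HypA p n μ J
  hD : 0 < D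
  hDE : D ≤ E
  hα : 0 < α
  hβ : 0 < β
  lower : ∀ x : V p n, x ≠ 0 → D * Real.log (1 + ‖x‖) ^ α / ‖x‖ ^ β ≤ J x
  upper : ∀ x : V p n, x ≠ 0 → J x ≤ E * Real.log (1 + ‖x‖) ^ α / ‖x‖ ^ β

/-- The lower incomplete gamma function `γ(s,x) = ∫_0^x z^{s-1} e^{-z} dz`. -/
def lgamma (s x : ℝ) : ℝ := ∫ z in (0:ℝ)..x, z ^ (s - 1) * Real.exp (-z)


lemma norm_sub_le_max_P (x y : ℚ_[p]) : ‖x - y‖ ≤ max ‖x‖ ‖y‖ := by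
  rw [sub_eq_add_neg, ← norm_neg y]
  exact IsUltrametricDist.norm_add_le_max _ _

/-- The fractional part of a `p`-adic integer vanishes. -/
lemma frac_eq_zero (y : ℚ_[p]) (hy : ‖y‖ ≤ 1) : frac p y = 0 := by
  unfold frac
  split_ifs with h
  · obtain ⟨h0, h1, ⟨m, hm⟩, h2⟩ := h.choose_spec
    generalize h.choose = r at h0 h1 hm h2
    have hpp : (0 : ℚ) < (p : ℚ) ^ m := by
      have := (Fact.out : p.Prime).pos
      positivity
    have hr : ‖(r : ℚ_[p])‖ ≤ 1 := by
      have e : (r : ℚ_[p]) = y - (y - r) := by ring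
      rw [e]
      exact (norm_sub_le_max_P p _ _).trans (max_le hy h2)
    have hk : (((r * (p : ℚ) ^ m).num : ℤ) : ℚ) = r * (p : ℚ) ^ m := Rat.coe_int_num_of_den_eq_one hm
    generalize (r * (p : ℚ) ^ m).num = k at hk
    have hk' : (k : ℚ_[p]) = (r : ℚ_[p]) * (p : ℚ_[p]) ^ m := by exact_mod_cast congrArg (Rat.cast : ℚ → ℚ_[p]) hk
    have hn : ‖(k : ℚ_[p])‖ ≤ (p : ℝ) ^ (-(m : ℤ)) := by
      rw [hk', norm_mul, Padic.norm_p_pow]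
      exact mul_le_of_le_one_left (by positivity) hr
    have hd := (Padic.norm_int_le_pow_iff_dvd k m).1 hn
    have hk0 : 0 ≤ k := by
      have : (0 : ℚ) ≤ k := by rw [hk]; positivity
      exact_mod_cast this
    have hk1 : k < (p : ℤ) ^ m := by
      have : (k : ℚ) < (p : ℚ) ^ m := by
        rw [hk]; exact mul_lt_of_lt_one_left hpp h1
      exact_mod_cast this
    have hkz : k = 0 := Int.eq_zero_of_dvd_of_nonneg_of_lt hk0 hk1 (by exact_mod_cast hd)
    rw [hkz] at hk
    have := mul_eq_zero.1 hk.symm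
    rcases this with h | h
    · exact h
    · exact absurd h hpp.ne'
  · rfl

lemma stdChar_eq_one (y : ℚ_[p]) (hy : ‖y‖ ≤ 1) : stdChar p y = 1 := by
  simp [stdChar, frac_eq_zero p y hy]

lemma norm_stdChar (y : ℚ_[p]) : ‖stdChar p y‖ = 1 := by
  unfold stdChar
  have : (2 * Real.pi * Complex.I * (frac p y : ℂ)) = ((2 * Real.pi * (frac p y : ℝ) : ℝ) : ℂ) * Complex.I := by
    push_cast; ring
  rw [this, Complex.norm_exp_ofReal_mul_I]

lemma norm_dotP_le (ξ x : V p n) : ‖dotP p n ξ x‖ ≤ ‖ξ‖ * ‖x‖ := by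
  unfold dotP
  refine IsUltrametricDist.norm_sum_le_of_forall_le_of_nonneg (by positivity) fun i _ => ?_
  rw [norm_mul]
  gcongr
  · exact norm_le_pi_norm ξ i
  · exact norm_le_pi_norm x i

/-- A norm preserving linear endomorphism preserves the Haar measure; hence invariance of `FJ`. -/
lemma FJ_comp (μ : Measure (V p n)) [μ.IsAddHaarMeasure]
    (hμ : μ (Zpn p n) = 1) (J : V p n → ℝ) (hJ : HypA p n μ J)
    (f : V p n →ₗ[ℚ_[p]] V p n) (hf : ∀ x, ‖f x‖ = ‖x‖) (ξ ξ' : V p n)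
    (h : ∀ x, dotP p n ξ' (f x) = dotP p n ξ x) : FJ p n μ J ξ = FJ p n μ J ξ' := by
  have hinj : Function.Injective f := by
    rw [injective_iff_map_eq_zero]
    intro x hx
    have := hf x
    rw [hx, norm_zero] at this
    exact norm_eq_zero.1 this.symm
  let e : V p n ≃ₗᵢ[ℚ_[p]] V p n := ⟨LinearEquiv.ofInjectiveEndo f hinj, hf⟩
  have he : ∀ x, e x = f x := fun x => rfl
  let E := e.toHomeomorph
  have hE : ∀ x, E x = f x := fun x => rfl
  have hmap : Measure.map E μ = μ := by
    have : (Measure.map E μ).IsAddHaarMeasure :=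
      AddEquiv.isAddHaarMeasure_map μ e.toLinearEquiv.toAddEquiv e.continuous e.symm.continuous
    have h1 := Measure.isAddLeftInvariant_eq_smul (Measure.map E μ) μ
    have hpre : E ⁻¹' (Zpn p n) = Zpn p n := by
      ext x
      simp [Zpn, hE, hf]
    have h2 : Measure.map E μ (Zpn p n) = 1 := by
      have hm : MeasurableSet (Zpn p n) := (isClosed_le continuous_norm continuous_const).measurableSet
      rw [Measure.map_apply E.continuous.measurable hm, hpre, hμ]
    have h3 : (Measure.addHaarScalarFactor (Measure.map E μ) μ) = 1 := by
      rw [h1, Measure.smul_apply, hμ] at h2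
      simpa [ENNReal.smul_def] using h2
    rw [h3, one_smul] at h1
    exact h1
  have hmp : MeasurePreserving E μ μ := ⟨E.continuous.measurable, hmap⟩
  unfold FJ FT
  symm
  rw [← hmp.integral_comp E.measurableEmbedding]
  refine integral_congr_ae (Eventually.of_forall fun x => ?_)
  simp only [hE, h]
  rw [hJ.radial (f x) x (hf x)]

/-- Reduction to a coordinate vector. -/
lemma FJ_single (μ : Measure (V p n)) [μ.IsAddHaarMeasure]
    (hμ : μ (Zpn p n) = 1) (J : V p n → ℝ) (hJ : HypA p n μ J) (ξ : V p n) (i : Fin n)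
    (hi : ‖ξ‖ = ‖ξ i‖) (h0 : ξ i ≠ 0) :
    FJ p n μ J ξ = FJ p n μ J (Pi.single i (ξ i)) := by
  let f : V p n →ₗ[ℚ_[p]] V p n :=
    { toFun := fun x => Function.update x i (dotP p n ξ x / ξ i)
      map_add' := by
        intro x y
        ext k
        by_cases hk : k = i
        · subst hk
          simp [dotP, mul_add, Finset.sum_add_distrib, add_div]
        · simp [hk]
      map_smul' := by
        intro c x
        ext k
        by_cases hk : k = i
        · subst hk
          simp only [dotP, Function.update_self, Pi.smul_apply, smul_eq_mul, RingHom.id_apply]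
          rw [← mul_div_assoc, Finset.mul_sum]
          congr 1
          exact Finset.sum_congr rfl fun j _ => by ring
        · simp [hk] }
  have hfi : ∀ x, f x i = dotP p n ξ x / ξ i := fun x => by simp [f]
  have hfk : ∀ x k, k ≠ i → f x k = x k := fun x k hk => by simp [f, hk]
  have hpos : 0 < ‖ξ i‖ := norm_pos_iff.2 h0
  refine FJ_comp p n μ hμ J hJ f (fun x => le_antisymm ?_ ?_) _ _ fun x => ?_
  · refine (pi_norm_le_iff_of_nonneg (norm_nonneg _)).2 fun k => ?_
    by_cases hk : k = i
    · subst hk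
      rw [hfi, norm_div, div_le_iff₀ hpos, mul_comm, ← hi]
      exact norm_dotP_le p n ξ x
    · rw [hfk x k hk]; exact norm_le_pi_norm x k
  · refine (pi_norm_le_iff_of_nonneg (norm_nonneg _)).2 fun k => ?_
    by_cases hk : k = i
    · subst hk
      have hs : ξ k * x k = ξ k * f x k - ∑ j ∈ Finset.univ.erase k, ξ j * x j := by
        rw [hfi, mul_div_cancel₀ _ h0, dotP, ← Finset.add_sum_erase _ _ (Finset.mem_univ k)]
        ring
      have hb : ‖ξ k * x k‖ ≤ ‖ξ k‖ * ‖f x‖ := by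
        rw [hs]
        refine (norm_sub_le_max_P p _ _).trans (max_le ?_ ?_)
        · rw [norm_mul]; gcongr; exact norm_le_pi_norm (f x) k
        · refine IsUltrametricDist.norm_sum_le_of_forall_le_of_nonneg (by positivity) fun j hj => ?_
          rw [norm_mul, ← hfk x j (Finset.ne_of_mem_erase hj), ← hi]
          gcongr
          · exact norm_le_pi_norm ξ j
          · exact norm_le_pi_norm (f x) j
      rw [norm_mul] at hb
      exact le_of_mul_le_mul_left hb hpos
    · rw [← hfk x k hk]; exact norm_le_pi_norm (f x) k
  · have : dotP p n (Pi.single i (ξ i)) (f x) = ξ i * f x i := by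
      unfold dotP
      rw [Finset.sum_eq_single i]
      · simp
      · intro j _ hj; simp [hj]
      · simp
    rw [this, hfi, mul_div_cancel₀ _ h0]

lemma exists_coord (hn : 0 < n) (ξ : V p n) : ∃ i, ‖ξ‖ = ‖ξ i‖ := by
  have : Nonempty (Fin n) := ⟨⟨0, hn⟩⟩
  obtain ⟨i, hi⟩ := Finite.exists_max (fun i => ‖ξ i‖)
  exact ⟨i, le_antisymm ((pi_norm_le_iff_of_nonneg (norm_nonneg _)).2 hi) (norm_le_pi_norm ξ i)⟩

/-- `FJ` is radial. -/
lemma FJ_radial (hn : 0 < n) (μ : Measure (V p n)) [μ.IsAddHaarMeasure]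
    (hμ : μ (Zpn p n) = 1) (J : V p n → ℝ) (hJ : HypA p n μ J) (ξ η : V p n)
    (h : ‖ξ‖ = ‖η‖) : FJ p n μ J ξ = FJ p n μ J η := by
  by_cases hξ : ξ = 0
  · subst hξ
    rw [norm_zero] at h
    rw [norm_eq_zero.1 h.symm]
  have hξ' : 0 < ‖ξ‖ := norm_pos_iff.2 hξ
  obtain ⟨i, hi⟩ := exists_coord p n hn ξ
  obtain ⟨k, hk⟩ := exists_coord p n hn η
  have hi0 : ξ i ≠ 0 := norm_pos_iff.1 (hi ▸ hξ')
  have hk0 : η k ≠ 0 := norm_pos_iff.1 (hk ▸ h ▸ hξ')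
  rw [FJ_single p n μ hμ J hJ ξ i hi hi0, FJ_single p n μ hμ J hJ η k hk hk0]
  have hc : ‖ξ i / η k‖ = 1 := by
    rw [norm_div, ← hi, ← hk, h, div_self (h ▸ hξ'.ne')]
  let f : V p n →ₗ[ℚ_[p]] V p n :=
    (ξ i / η k) • LinearMap.funLeft ℚ_[p] ℚ_[p] (Equiv.swap i k)
  have hf : ∀ x j, f x j = ξ i / η k * x (Equiv.swap i k j) := fun x j => by
    simp [f, LinearMap.funLeft_apply]
  have hfn : ∀ x j, ‖f x j‖ = ‖x (Equiv.swap i k j)‖ := fun x j => by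
    rw [hf, norm_mul, hc, one_mul]
  refine FJ_comp p n μ hμ J hJ f (fun x => le_antisymm ?_ ?_) _ _ fun x => ?_
  · refine (pi_norm_le_iff_of_nonneg (norm_nonneg _)).2 fun j => ?_
    rw [hfn]; exact norm_le_pi_norm x _
  · refine (pi_norm_le_iff_of_nonneg (norm_nonneg _)).2 fun j => ?_
    have := hfn x (Equiv.swap i k j)
    rw [Equiv.swap_apply_self] at this
    rw [← this]; exact norm_le_pi_norm (f x) _
  · have key : ∀ (l : Fin n) (c : ℚ_[p]) (y : V p n), dotP p n (Pi.single l c) y = c * y l := by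
      intro l c y
      unfold dotP
      rw [Finset.sum_eq_single l]
      · simp
      · intro j _ hj; simp [hj]
      · simp
    rw [key, key, hf, Equiv.swap_apply_right]
    field_simp

lemma norm_FJ_le (μ : Measure (V p n)) (J : V p n → ℝ) (hJ : HypA p n μ J) (ξ : V p n) :
    ‖FJ p n μ J ξ‖ ≤ 1 := by
  unfold FJ FT
  refine (norm_integral_le_integral_norm _).trans ?_
  rw [← hJ.int_one]
  refine le_of_eq (integral_congr_ae (Eventually.of_forall fun x => ?_))
  simp [norm_stdChar, abs_of_nonneg (hJ.nonneg x)]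

/-- The ball of radius `p^{-j}`. -/
def ballP (j : ℕ) : Set (V p n) := {x | ‖x‖ ≤ (p : ℝ) ^ (-(j : ℤ))}

lemma measurableSet_ballP (j : ℕ) : MeasurableSet (ballP p n j) :=
  (isClosed_le continuous_norm continuous_const).measurableSet

lemma mem_ballP (j : ℕ) (x : V p n) :
    x ∈ ballP p n j ↔ ∀ i, ‖x i‖ ≤ (p : ℝ) ^ (-(j : ℤ)) :=
  pi_norm_le_iff_of_nonneg (by positivity)

lemma p_pos : (0 : ℝ) < p := by exact_mod_cast (Fact.out : p.Prime).pos

lemma mem_ballP_succ (j : ℕ) (x : V p n) :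
    x ∈ ballP p n (j + 1) ↔ ‖x‖ < (p : ℝ) ^ (-(j : ℤ)) := by
  have := p_pos p
  rw [mem_ballP, pi_norm_lt_iff (by positivity)]
  refine forall_congr' fun i => ?_
  rw [Padic.norm_le_pow_iff_norm_lt_pow_add_one]
  simp

/-- Representatives of the cosets of `p^{j+1} ℤ_p^n` in `p^j ℤ_p^n`. -/
def rep (j : ℕ) (a : Fin n → Fin p) : V p n := fun i => (p : ℚ_[p]) ^ j * ((a i : ℕ) : ℚ_[p])

lemma p_ne : (p : ℚ_[p]) ≠ 0 := by exact_mod_cast (Fact.out : p.Prime).ne_zero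

lemma ballP_eq (j : ℕ) :
    ballP p n j = ⋃ a : Fin n → Fin p, (fun x => rep p n j a + x) '' ballP p n (j + 1) := by
  have hp := p_pos p
  have hpow : (p : ℝ) ^ (-((j + 1 : ℕ) : ℤ)) ≤ (p : ℝ) ^ (-(j : ℤ)) := by
    apply zpow_le_zpow_right₀
    · exact_mod_cast (Fact.out : p.Prime).one_lt.le
    · push_cast; omega
  ext x
  simp only [Set.mem_iUnion, Set.mem_image]
  constructor
  · intro hx
    rw [mem_ballP] at hx
    have hz : ∀ i, ‖x i / (p : ℚ_[p]) ^ j‖ ≤ 1 := fun i => by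
      rw [norm_div, Padic.norm_p_pow, div_le_one (by positivity)]
      exact hx i
    have hz' : ∀ i, ∃ z : ℤ_[p], (z : ℚ_[p]) = x i / (p : ℚ_[p]) ^ j := fun i => ⟨⟨_, hz i⟩, rfl⟩
    choose z hzz using hz'
    choose a ha ha' using fun i => PadicInt.exists_mem_range (z i)
    refine ⟨fun i => ⟨a i, ha i⟩, x - rep p n j (fun i => ⟨a i, ha i⟩), ?_, by simp⟩
    rw [mem_ballP_succ, pi_norm_lt_iff (by positivity)]
    intro i
    have h1 := ha' i
    rw [IsLocalRing.mem_maximalIdeal, PadicInt.mem_nonunits, PadicInt.norm_def,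
      PadicInt.coe_sub, PadicInt.coe_natCast, hzz] at h1
    have h2 : (x - rep p n j (fun i => ⟨a i, ha i⟩)) i
        = (p : ℚ_[p]) ^ j * (x i / (p : ℚ_[p]) ^ j - (a i : ℚ_[p])) := by
      have := p_ne p
      simp only [rep, Pi.sub_apply]
      field_simp
    rw [h2, norm_mul, Padic.norm_p_pow]
    exact mul_lt_of_lt_one_right (by positivity) h1
  · rintro ⟨a, y, hy, rfl⟩
    rw [mem_ballP] at hy ⊢
    intro i
    refine (IsUltrametricDist.norm_add_le_max _ _).trans (max_le ?_ ((hy i).trans hpow))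
    simp only [rep]
    rw [norm_mul, Padic.norm_p_pow]
    refine mul_le_of_le_one_right (by positivity) ?_
    exact_mod_cast Padic.norm_int_le_one (p := p) ((a i : ℕ) : ℤ)

lemma ballP_disj (j : ℕ) : Pairwise (Function.onFun Disjoint
    fun a : Fin n → Fin p => (fun x => rep p n j a + x) '' ballP p n (j + 1)) := by
  have hp := p_pos p
  intro a b hab
  rw [Function.onFun, Set.disjoint_left]
  rintro _ ⟨x, hx, rfl⟩ ⟨y, hy, hxy⟩
  apply hab
  ext i
  rw [mem_ballP_succ, pi_norm_lt_iff (by positivity)] at hx hy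
  have h1 : (p : ℚ_[p]) ^ j * (((a i : ℕ) : ℤ) - ((b i : ℕ) : ℤ) : ℤ) = y i - x i := by
    have := congrFun hxy i
    simp only [rep, Pi.add_apply] at this
    push_cast
    linear_combination -this
  have h2 : ‖y i - x i‖ < (p : ℝ) ^ (-(j : ℤ)) :=
    (norm_sub_le_max_P p _ _).trans_lt (max_lt (hy i) (hx i))
  rw [← h1, norm_mul, Padic.norm_p_pow] at h2
  have h3 : ‖((((a i : ℕ) : ℤ) - ((b i : ℕ) : ℤ) : ℤ) : ℚ_[p])‖ < 1 := by
    have hq : (0 : ℝ) < (p : ℝ) ^ (-(j : ℤ)) := by positivity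
    exact lt_of_mul_lt_mul_left (by simpa using h2) hq.le
  rw [Padic.norm_intCast_lt_one_iff] at h3
  have ha := (a i).2
  have hb := (b i).2
  have : ((a i : ℕ) : ℤ) - ((b i : ℕ) : ℤ) = 0 :=
    Int.eq_zero_of_abs_lt_dvd h3 (by rw [abs_lt]; constructor <;> omega)
  omega

lemma measure_ballP (μ : Measure (V p n)) [μ.IsAddHaarMeasure]
    (hμ : μ (Zpn p n) = 1) (j : ℕ) :
    μ.real (ballP p n j) = (p : ℝ) ^ (-((n * j : ℕ) : ℤ)) := by
  have hp := p_pos p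
  induction j with
  | zero =>
    have : ballP p n 0 = Zpn p n := by simp [ballP, Zpn]
    rw [this, measureReal_def, hμ]
    simp
  | succ j ih =>
    have hm : ∀ a : Fin n → Fin p, μ ((fun x => rep p n j a + x) '' ballP p n (j + 1))
        = μ (ballP p n (j + 1)) := fun a => by
      rw [Set.image_add_left, measure_preimage_add]
    have hms : ∀ a : Fin n → Fin p,
        MeasurableSet ((fun x => rep p n j a + x) '' ballP p n (j + 1)) := fun a => by
      rw [Set.image_add_left]
      exact (measurableSet_ballP p n (j + 1)).preimage (continuous_const_add _).measurable
    have h1 : μ (ballP p n j) = (p : ENNReal) ^ n * μ (ballP p n (j + 1)) := by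
      conv_lhs => rw [ballP_eq]
      rw [measure_iUnion (ballP_disj p n j) hms, tsum_fintype]
      simp only [hm, Finset.sum_const, Finset.card_univ, Fintype.card_fun, Fintype.card_fin,
        nsmul_eq_mul]
      push_cast
      rfl
    have h2 : μ.real (ballP p n j) = (p : ℝ) ^ n * μ.real (ballP p n (j + 1)) := by
      simp [measureReal_def, h1]
    rw [ih] at h2
    have h3 : (p : ℝ) ^ (-((n * j : ℕ) : ℤ))
        = (p : ℝ) ^ n * (p : ℝ) ^ (-((n * (j + 1) : ℕ) : ℤ)) := by
      rw [← zpow_natCast, ← zpow_add₀ hp.ne']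
      congr 1
      push_cast
      ring
    rw [h3] at h2
    exact (mul_left_cancel₀ (by positivity) h2).symm

/-- The sphere of radius `p^{-j}`. -/
def sphP (j : ℕ) : Set (V p n) := {x | ‖x‖ = (p : ℝ) ^ (-(j : ℤ))}

lemma sphP_eq (j : ℕ) : sphP p n j = ballP p n j \ ballP p n (j + 1) := by
  ext x
  rw [Set.mem_sdiff, mem_ballP_succ, not_lt]
  exact le_antisymm_iff

lemma ballP_anti (j : ℕ) : ballP p n (j + 1) ⊆ ballP p n j := fun x hx =>
  ((mem_ballP_succ p n j x).1 hx).le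

lemma ballP_ne_top (μ : Measure (V p n)) [μ.IsAddHaarMeasure] (hμ : μ (Zpn p n) = 1) (j : ℕ) :
    μ (ballP p n j) ≠ ⊤ := by
  intro h
  have := measure_ballP p n μ hμ j
  rw [measureReal_def, h] at this
  have hp := p_pos p
  have h2 : (0 : ℝ) < (p : ℝ) ^ (-((n * j : ℕ) : ℤ)) := by positivity
  rw [← this] at h2
  simp at h2

lemma measure_sphP (μ : Measure (V p n)) [μ.IsAddHaarMeasure]
    (hμ : μ (Zpn p n) = 1) (j : ℕ) :
    μ.real (sphP p n j) = (1 - (p : ℝ) ^ (-(n : ℤ))) * (p : ℝ) ^ (-((n * j : ℕ) : ℤ)) := by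
  rw [sphP_eq, measureReal_sdiff (ballP_anti p n j) (measurableSet_ballP p n _)
    (ballP_ne_top p n μ hμ j), measure_ballP p n μ hμ, measure_ballP p n μ hμ,
    sub_mul, one_mul, ← zpow_add₀ (p_pos p).ne']
  congr 2
  push_cast
  ring

lemma Zpn_eq (hn : 0 < n) : Zpn p n = (⋃ j, sphP p n j) ∪ {0} := by
  have hp1 : (1 : ℝ) < p := by exact_mod_cast (Fact.out : p.Prime).one_lt
  ext x
  simp only [Zpn, sphP, Set.mem_union, Set.mem_iUnion, Set.mem_ofPred_eq, Set.mem_singleton_iff]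
  constructor
  · intro hx
    by_cases h0 : x = 0
    · exact Or.inr h0
    left
    obtain ⟨i, hi⟩ := exists_coord p n hn x
    have hi0 : x i ≠ 0 := norm_pos_iff.1 (hi ▸ norm_pos_iff.2 h0)
    have hv := Padic.norm_eq_zpow_neg_valuation hi0
    rw [hi, hv] at hx
    rw [hi, hv]
    have hle : -(x i).valuation ≤ 0 := by
      by_contra hcon
      push Not at hcon
      exact absurd hx (not_le.2 (one_lt_zpow₀ hp1 hcon))
    refine ⟨(x i).valuation.toNat, ?_⟩
    rw [Int.toNat_of_nonneg (by omega)]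
  · rintro (⟨j, hj⟩ | rfl)
    · rw [hj]
      exact zpow_le_one_of_nonpos₀ hp1.le (by omega)
    · simp

lemma norm_repVec (hn : 0 < n) (j : ℕ) :
    ‖repVec p n ((p : ℝ) ^ (-(j : ℤ)))‖ = (p : ℝ) ^ (-(j : ℤ)) := by
  have : Nonempty (Fin n) := ⟨⟨0, hn⟩⟩
  have h : ∃ v : V p n, ‖v‖ = (p : ℝ) ^ (-(j : ℤ)) :=
    ⟨fun _ => (p : ℚ_[p]) ^ j, by rw [pi_norm_const, Padic.norm_p_pow]⟩
  unfold repVec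
  rw [dif_pos h]
  exact h.choose_spec

lemma measure_zero (hn : 0 < n) (μ : Measure (V p n)) [μ.IsAddHaarMeasure]
    (hμ : μ (Zpn p n) = 1) : μ {(0 : V p n)} = 0 := by
  have hp1 : (1 : ℝ) < p := by exact_mod_cast (Fact.out : p.Prime).one_lt
  have hsub : ∀ j, ({(0 : V p n)} : Set (V p n)) ⊆ ballP p n j := fun j x hx => by
    rw [Set.mem_singleton_iff] at hx
    subst hx
    simp only [ballP, Set.mem_ofPred_eq, norm_zero]
    positivity
  have hb : ∀ j : ℕ, μ.real {(0 : V p n)} ≤ (((p : ℝ)⁻¹) ^ n) ^ j := fun j => by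
    have := measureReal_mono (hsub j) (ballP_ne_top p n μ hμ j)
    rw [measure_ballP p n μ hμ] at this
    rwa [zpow_neg, zpow_natCast, ← inv_pow, pow_mul] at this
  have hlim : Tendsto (fun j : ℕ => (((p : ℝ)⁻¹) ^ n) ^ j) atTop (nhds 0) :=
    tendsto_pow_atTop_nhds_zero_of_lt_one (by positivity)
      (pow_lt_one₀ (by positivity) (inv_lt_one_of_one_lt₀ hp1) hn.ne')
  have h0 : μ.real {(0 : V p n)} = 0 :=
    le_antisymm (ge_of_tendsto' hlim hb) measureReal_nonneg
  rw [measureReal_def, ENNReal.toReal_eq_zero_iff] at h0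
  exact h0.resolve_right (ne_top_of_le_ne_top (ballP_ne_top p n μ hμ 0) (measure_mono (hsub 0)))

/-- the survival probability `S(t) = ∫_{ℤ_p^n} u(x,t) d^n x` satisfies
`S(t) = ∫_{ℤ_p^n} e^{-t(1-(FJ)(ξ))} d^n ξ = (1-p^{-n}) Σ_{j≥0} p^{-nj} e^{-t(1-(FJ)(p^{-j}))}`. -/
theorem statement17 (hn : 0 < n) (μ : Measure (V p n)) [μ.IsAddHaarMeasure]
    (hμ : μ (Zpn p n) = 1) (J : V p n → ℝ) (hJ : HypA p n μ J) :
    ∀ t : ℝ, 0 ≤ t →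
      (∫ x in Zpn p n,
          (∫ ξ in Zpn p n,
            stdChar p (-(dotP p n ξ x)) * Complex.exp (-(t : ℂ) * (1 - FJ p n μ J ξ)) ∂μ) ∂μ) =
        (∫ ξ in Zpn p n, Complex.exp (-(t : ℂ) * (1 - FJ p n μ J ξ)) ∂μ) ∧
      (∫ ξ in Zpn p n, Complex.exp (-(t : ℂ) * (1 - FJ p n μ J ξ)) ∂μ) =
        ((1 - (p : ℝ) ^ (-(n : ℤ)) : ℝ) : ℂ) *
          ∑' j : ℕ, (((p : ℝ) ^ (-((n * j : ℕ) : ℤ)) : ℝ) : ℂ) *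
            Complex.exp (-(t : ℂ) * (1 - FJ p n μ J (repVec p n ((p : ℝ) ^ (-(j : ℤ)))))) := by
  intro t ht
  have hmZ : MeasurableSet (Zpn p n) :=
    (isClosed_le continuous_norm continuous_const).measurableSet
  constructor
  · have h1 : ∀ x ∈ Zpn p n, (∫ ξ in Zpn p n,
        stdChar p (-(dotP p n ξ x)) * Complex.exp (-(t : ℂ) * (1 - FJ p n μ J ξ)) ∂μ)
        = ∫ ξ in Zpn p n, Complex.exp (-(t : ℂ) * (1 - FJ p n μ J ξ)) ∂μ := by
      intro x hx
      refine setIntegral_congr_fun hmZ fun ξ hξ => ?_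
      have : ‖-(dotP p n ξ x)‖ ≤ 1 := by
        rw [norm_neg]
        exact (norm_dotP_le p n ξ x).trans (mul_le_one₀ hξ (norm_nonneg _) hx)
      simp only [stdChar_eq_one p _ this, one_mul]
    rw [setIntegral_congr_fun hmZ h1, setIntegral_const, measureReal_def, hμ]
    simp
  · set g : V p n → ℂ := fun ξ => Complex.exp (-(t : ℂ) * (1 - FJ p n μ J ξ)) with hg
    have hms : ∀ j, MeasurableSet (sphP p n j) := fun j =>
      (isClosed_eq continuous_norm continuous_const).measurableSet
    have hconst : ∀ j, ∀ ξ ∈ sphP p n j, g ξ = g (repVec p n ((p : ℝ) ^ (-(j : ℤ)))) := by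
      intro j ξ hξ
      simp only [hg]
      rw [FJ_radial p n hn μ hμ J hJ ξ (repVec p n ((p : ℝ) ^ (-(j : ℤ))))]
      rw [norm_repVec p n hn]
      exact hξ
    have hbd : ∀ ξ, ‖g ξ‖ ≤ 1 := by
      intro ξ
      simp only [hg]
      rw [Complex.norm_exp, Real.exp_le_one_iff]
      have h1 : (FJ p n μ J ξ).re ≤ 1 := (Complex.re_le_norm _).trans (norm_FJ_le p n μ J hJ ξ)
      have h2 : (-(t : ℂ) * (1 - FJ p n μ J ξ)).re = -(t * (1 - (FJ p n μ J ξ).re)) := by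
        simp
      rw [h2]
      have := mul_nonneg ht (sub_nonneg.2 h1)
      linarith
    have hZ := Zpn_eq p n hn
    have hae : (Zpn p n : Set (V p n)) =ᵐ[μ] (⋃ j, sphP p n j : Set (V p n)) := by
      rw [hZ]
      exact union_ae_eq_left_of_ae_eq_empty (ae_eq_empty.2 (measure_zero p n hn μ hμ))
    have hfin : μ (⋃ j, sphP p n j) < ⊤ := by
      rw [← measure_congr hae, hμ]; simp
    have hint : IntegrableOn g (⋃ j, sphP p n j) μ := by
      refine ⟨?_, ?_⟩
      · rw [aestronglyMeasurable_iUnion_iff]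
        intro j
        refine (aestronglyMeasurable_const
          (b := g (repVec p n ((p : ℝ) ^ (-(j : ℤ)))))).congr ?_
        exact (ae_restrict_of_forall_mem (hms j) fun ξ hξ => (hconst j ξ hξ).symm)
      · have : IsFiniteMeasure (μ.restrict (⋃ j, sphP p n j)) := ⟨by simpa using hfin⟩
        exact HasFiniteIntegral.of_bounded (C := 1) (Eventually.of_forall hbd)
    have hdisj : Pairwise (Function.onFun Disjoint (sphP p n)) := by
      intro a b hab
      rw [Function.onFun, Set.disjoint_left]
      intro x hxa hxb
      have h1 : (p : ℝ) ^ (-(a : ℤ)) = (p : ℝ) ^ (-(b : ℤ)) := Eq.trans (Eq.symm hxa) hxb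
      have hp1 : (1 : ℝ) < p := by exact_mod_cast (Fact.out : p.Prime).one_lt
      have := zpow_right_injective₀ (by linarith) hp1.ne' h1
      exact hab (by omega)
    rw [setIntegral_congr_set hae, integral_iUnion hms hdisj hint, ← tsum_mul_left]
    refine tsum_congr fun j => ?_
    rw [setIntegral_congr_fun (hms j) (hconst j), setIntegral_const, measure_sphP p n μ hμ,
      Complex.real_smul]
    push_cast
    ring

end PadicPaper
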